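/- arXiv:0910.2127 — 2 statements merged into one kernel-verified Lean document; each statement's English description precedes it below -/
import Mathlib

section
/- For all real numbers a, b, c, d with 0 < a < b < c < d and all τ ∈ ℂ with Im τ > 0: Σ_{(l,k) ∈ L₁×L₁} (B(l,k)² − B(Ψ(l),Ψ(k))²)·q^{Q(l)+Q(k)} = 8·Σ_{0≤i<j≤3} Σ_{(m,m') ∈ M×M} (B(m+vᵢ, m'+vⱼ)² − B(Ψ(m+vᵢ), Ψ(m'+vⱼ))²)·q^{Q(m+vᵢ)+Q(m'+vⱼ)}; that is, δ(τ) = Σ_{0≤i<j≤3} δ_{[vᵢ],[vⱼ]}(τ). -/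
/-- The diagonal quadratic form `Q(x) = a x₀² + b x₁² + c x₂² + d x₃²` on `ℤ⁴`. -/
def Q (a b c d : ℝ) (x : Fin 4 → ℤ) : ℝ :=
  a * (x 0 : ℝ) ^ 2 + b * (x 1 : ℝ) ^ 2 + c * (x 2 : ℝ) ^ 2 + d * (x 3 : ℝ) ^ 2

/-- The associated symmetric bilinear form on `ℤ⁴`. -/
def B (a b c d : ℝ) (x y : Fin 4 → ℤ) : ℝ :=
  a * (x 0 : ℝ) * (y 0 : ℝ) + b * (x 1 : ℝ) * (y 1 : ℝ) +
    c * (x 2 : ℝ) * (y 2 : ℝ) + d * (x 3 : ℝ) * (y 3 : ℝ)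

def l0 : Fin 4 → ℤ := ![-1, 3, -1, 1]
def l1 : Fin 4 → ℤ := ![1, -1, -1, 3]
def l2 : Fin 4 → ℤ := ![-1, -1, 1, 3]
def l3 : Fin 4 → ℤ := ![-1, 1, -1, 3]

/-- `L₁ = span_ℤ {l₀, l₁, 3 l₂, 3 l₃}`. -/
def L1 : Submodule ℤ (Fin 4 → ℤ) :=
  Submodule.span ℤ {l0, l1, (3 : ℤ) • l2, (3 : ℤ) • l3}

/-- `L₂ = span_ℤ {l₀, 3 l₁, l₂, 3 l₃}`. -/
def L2 : Submodule ℤ (Fin 4 → ℤ) :=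
  Submodule.span ℤ {l0, (3 : ℤ) • l1, l2, (3 : ℤ) • l3}

/-- `M = span_ℤ {(−3,3,3,3), (3,−3,3,3), (3,3,−3,3), (3,3,3,−3)}`. -/
def M : Submodule ℤ (Fin 4 → ℤ) :=
  Submodule.span ℤ {![-3, 3, 3, 3], ![3, -3, 3, 3], ![3, 3, -3, 3], ![3, 3, 3, -3]}

/-- The coset representatives `v₀, v₁, v₂, v₃` of `L₁/M`. -/
def v : Fin 4 → (Fin 4 → ℤ) :=
  ![![-1, 3, -1, 1], ![1, -1, -1, 3], ![3, 1, -1, -1], ![-1, -1, -3, -1]]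

/-- The Kleinian four group elements `g₀ = id`, `g₁ = diag(−1,1,−1,1)`,
`g₂ = diag(−1,−1,1,1)`, `g₃ = diag(1,−1,−1,1)` acting diagonally on `ℤ⁴`. -/
def g : Fin 4 → (Fin 4 → ℤ) → (Fin 4 → ℤ) :=
  ![fun x => x,
    fun x => ![-(x 0), x 1, -(x 2), x 3],
    fun x => ![-(x 0), -(x 1), x 2, x 3],
    fun x => ![x 0, -(x 1), -(x 2), x 3]]

open Classical in
/-- The Conway–Sloane bijection `Ψ : L₁ → L₂`, given by `Ψ(m) = m` for `m ∈ M` and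
`Ψ(m ± vᵢ) = gᵢ(m ± vᵢ)`  (note `g₀ = id`, so the classes `[0], [±v₀]` are fixed). -/
noncomputable def Psi (x : Fin 4 → ℤ) : Fin 4 → ℤ :=
  if x - v 1 ∈ M ∨ x + v 1 ∈ M then g 1 x
  else if x - v 2 ∈ M ∨ x + v 2 ∈ M then g 2 x
  else if x - v 3 ∈ M ∨ x + v 3 ∈ M then g 3 x
  else x

/-- `q^r := exp(2πiτr)`. -/
noncomputable def qpow (τ : ℂ) (r : ℝ) : ℂ :=
  Complex.exp (2 * Real.pi * Complex.I * τ * (r : ℂ))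

lemma g_neg (i : Fin 4) (x : Fin 4 → ℤ) : g i (-x) = -g i x := by
  ext j
  fin_cases i <;> fin_cases j <;> simp [g]

lemma g_g (i : Fin 4) (x : Fin 4 → ℤ) : g i (g i x) = x := by
  ext j
  fin_cases i <;> fin_cases j <;> simp [g]

lemma Q_g (a b c d : ℝ) (i : Fin 4) (x : Fin 4 → ℤ) : Q a b c d (g i x) = Q a b c d x := by
  fin_cases i <;> simp [g, Q]

lemma B_g_right (a b c d : ℝ) (i : Fin 4) (x y : Fin 4 → ℤ) :
    B a b c d x (g i y) = B a b c d (g i x) y := by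
  fin_cases i <;> simp [g, B]

lemma B_comm (a b c d : ℝ) (x y : Fin 4 → ℤ) : B a b c d x y = B a b c d y x := by
  simp only [B]; ring

lemma B_neg_left (a b c d : ℝ) (x y : Fin 4 → ℤ) : B a b c d (-x) y = -B a b c d x y := by
  simp only [B, Pi.neg_apply, Int.cast_neg]; ring

lemma Q_neg (a b c d : ℝ) (x : Fin 4 → ℤ) : Q a b c d (-x) = Q a b c d x := by
  simp [Q]

/-- Membership in `M` is a finite list of congruence conditions. -/
lemma mem_M_iff (x : Fin 4 → ℤ) :
    x ∈ M ↔ (3 ∣ x 0 ∧ 3 ∣ x 1 ∧ 3 ∣ x 2 ∧ 3 ∣ x 3) ∧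
      (2 ∣ x 1 - x 0 ∧ 2 ∣ x 2 - x 0 ∧ 2 ∣ x 3 - x 0) ∧ 4 ∣ -x 0 + x 1 + x 2 + x 3 := by
  simp only [M, Submodule.mem_span_insert, Submodule.mem_span_singleton]
  constructor
  · rintro ⟨p, _, ⟨q, _, ⟨r, _, ⟨s, rfl⟩, rfl⟩, rfl⟩, rfl⟩
    simp
    omega
  · rintro ⟨⟨⟨y₀, h₀⟩, ⟨y₁, h₁⟩, ⟨y₂, h₂⟩, ⟨y₃, h₃⟩⟩, h, h'⟩
    obtain ⟨e₁, he₁⟩ : 2 ∣ y₁ - y₀ := by omega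
    obtain ⟨e₂, he₂⟩ : 2 ∣ y₂ - y₀ := by omega
    obtain ⟨e₃, he₃⟩ : 2 ∣ y₃ - y₀ := by omega
    obtain ⟨p, hp⟩ : 4 ∣ -y₀ + y₁ + y₂ + y₃ := by omega
    clear h h'
    refine ⟨p, _, ⟨p - e₁, _, ⟨p - e₂, _, ⟨p - e₃, rfl⟩, rfl⟩, rfl⟩, ?_⟩
    ext j
    fin_cases j <;> simp [h₀, h₁, h₂, h₃] <;> linarith

lemma g_mem_M (i : Fin 4) {x : Fin 4 → ℤ} (hx : x ∈ M) : g i x ∈ M := by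
  rw [mem_M_iff] at hx ⊢
  fin_cases i <;> simp [g] <;> omega

lemma neg_sub_or_neg_add_mem_M (x w : Fin 4 → ℤ) :
    (-x - w ∈ M ∨ -x + w ∈ M) ↔ (x - w ∈ M ∨ x + w ∈ M) := by
  rw [← neg_add', neg_mem_iff, neg_add_eq_sub, ← neg_sub x w, neg_mem_iff, or_comm]

open Classical in
lemma Psi_neg (x : Fin 4 → ℤ) : Psi (-x) = -Psi x := by
  have h (i : Fin 4) := neg_sub_or_neg_add_mem_M x (v i)
  unfold Psi
  rw [if_congr (h 1) rfl (if_congr (h 2) rfl (if_congr (h 3) rfl rfl))]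
  simp only [g_neg]
  split_ifs <;> rfl

lemma exists_Psi_eq_g (x : Fin 4 → ℤ) : ∃ i, Psi x = g i x := by
  unfold Psi
  split_ifs
  exacts [⟨1, rfl⟩, ⟨2, rfl⟩, ⟨3, rfl⟩, ⟨0, rfl⟩]

lemma Q_Psi (a b c d : ℝ) (x : Fin 4 → ℤ) : Q a b c d (Psi x) = Q a b c d x := by
  obtain ⟨i, hi⟩ := exists_Psi_eq_g x
  rw [hi, Q_g]

lemma v_notMem_M (i : Fin 4) : v i ∉ M := by
  rw [mem_M_iff]
  revert i
  decide

lemma v_sub_or_v_add_mem_M_iff (i j : Fin 4) : (v i - v j ∈ M ∨ v i + v j ∈ M) ↔ i = j := by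
  simp only [mem_M_iff]
  revert i j
  decide

lemma Psi_of_mem_M {m : Fin 4 → ℤ} (hm : m ∈ M) : Psi m = m := by
  simp [Psi, sub_eq_add_neg, Submodule.add_mem_iff_right M hm, v_notMem_M]

lemma Psi_add_v {m : Fin 4 → ℤ} (hm : m ∈ M) (i : Fin 4) : Psi (m + v i) = g i (m + v i) := by
  simp only [Psi, add_assoc, add_sub_assoc, Submodule.add_mem_iff_right M hm,
    v_sub_or_v_add_mem_M_iff]
  fin_cases i <;> simp [g]

/-- The summand of the series `δ(τ)`. -/
noncomputable def deltaTerm (a b c d : ℝ) (τ : ℂ) (x y : Fin 4 → ℤ) : ℂ :=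
  ((B a b c d x y ^ 2 - B a b c d (Psi x) (Psi y) ^ 2 : ℝ) : ℂ) *
    qpow τ (Q a b c d x + Q a b c d y)

lemma deltaTerm_comm (a b c d : ℝ) (τ : ℂ) (x y : Fin 4 → ℤ) :
    deltaTerm a b c d τ x y = deltaTerm a b c d τ y x := by
  simp only [deltaTerm, B_comm a b c d x y, B_comm a b c d (Psi x), add_comm (Q a b c d x)]

lemma deltaTerm_neg_left (a b c d : ℝ) (τ : ℂ) (x y : Fin 4 → ℤ) :
    deltaTerm a b c d τ (-x) y = deltaTerm a b c d τ x y := by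
  simp only [deltaTerm, Psi_neg, B_neg_left, Q_neg, neg_sq]

/-- The part of the series `δ(τ)` supported on the pair of cosets `(r + M) × (s + M)`. -/
noncomputable def deltaCoset (a b c d : ℝ) (τ : ℂ) (r s : Fin 4 → ℤ) : ℂ :=
  ∑' p : M × M, deltaTerm a b c d τ (p.1 + r) (p.2 + s)

section deltaCoset

variable (a b c d : ℝ) (τ : ℂ)

lemma deltaCoset_comm (r s : Fin 4 → ℤ) :
    deltaCoset a b c d τ r s = deltaCoset a b c d τ s r := by
  rw [deltaCoset, ← (Equiv.prodComm M M).tsum_eq]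
  exact tsum_congr fun p ↦ deltaTerm_comm ..

lemma deltaCoset_neg_left (r s : Fin 4 → ℤ) :
    deltaCoset a b c d τ (-r) s = deltaCoset a b c d τ r s := by
  rw [deltaCoset, ← ((Equiv.neg M).prodCongr (Equiv.refl M)).tsum_eq]
  refine tsum_congr fun p ↦ ?_
  simp [← neg_add_rev, add_comm r, deltaTerm_neg_left]

lemma deltaCoset_units_smul_left (ε : ℤˣ) (r s : Fin 4 → ℤ) :
    deltaCoset a b c d τ ((ε : ℤ) • r) s = deltaCoset a b c d τ r s := by
  rcases Int.units_eq_one_or ε with rfl | rfl <;> simp [deltaCoset_neg_left]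

lemma deltaCoset_units_smul_right (ε : ℤˣ) (r s : Fin 4 → ℤ) :
    deltaCoset a b c d τ r ((ε : ℤ) • s) = deltaCoset a b c d τ r s := by
  rw [deltaCoset_comm, deltaCoset_units_smul_left, deltaCoset_comm]

lemma deltaCoset_zero_zero : deltaCoset a b c d τ 0 0 = 0 := by
  simp [deltaCoset, deltaTerm, Psi_of_mem_M]

lemma deltaCoset_v_self (i : Fin 4) : deltaCoset a b c d τ (v i) (v i) = 0 := by
  simp [deltaCoset, deltaTerm, Psi_add_v, B_g_right, g_g]

/-- The involution of `M` given by the sign change `gᵢ`. -/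
def gEquivM (i : Fin 4) : M ≃ M where
  toFun m := ⟨g i m, g_mem_M i m.2⟩
  invFun m := ⟨g i m, g_mem_M i m.2⟩
  left_inv m := Subtype.ext (g_g i m)
  right_inv m := Subtype.ext (g_g i m)

/-- The class of `0` does not interact with `[vᵢ]`: the involution `gᵢ` of the first factor
negates every term. -/
lemma deltaCoset_zero_v (i : Fin 4) : deltaCoset a b c d τ 0 (v i) = 0 := by
  rw [← self_eq_neg]
  conv_lhs => rw [deltaCoset, ← ((gEquivM i).prodCongr (Equiv.refl M)).tsum_eq]
  rw [deltaCoset, ← tsum_neg]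
  refine tsum_congr fun p ↦ ?_
  have h := g_mem_M i p.1.2
  simp [deltaTerm, gEquivM, Psi_of_mem_M, h, Psi_add_v, B_g_right, g_g, Q_g]
  ring

lemma deltaCoset_v_zero (i : Fin 4) : deltaCoset a b c d τ (v i) 0 = 0 := by
  rw [deltaCoset_comm, deltaCoset_zero_v]

end deltaCoset

/-- Representatives of the nine classes `[0], [±vᵢ]` of `L₁/M`. -/
def cosetRep : Option (ℤˣ × Fin 4) → Fin 4 → ℤ
  | none => 0
  | some (ε, i) => (ε : ℤ) • v i

lemma cosetRep_injective_mod_M (o o' : Option (ℤˣ × Fin 4))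
    (h : cosetRep o - cosetRep o' ∈ M) : o = o' := by
  rw [mem_M_iff] at h
  revert o o'
  decide

lemma exists_cosetRep_of_fin_three (e f : Fin 3) :
    ∃ o, (e : ℤ) • v 0 + (f : ℤ) • v 1 - cosetRep o ∈ M := by
  simp only [mem_M_iff]
  revert e f
  decide

lemma mem_L1_iff (x : Fin 4 → ℤ) :
    x ∈ L1 ↔ ∃ p q r s : ℤ,
      x = p • l0 + q • l1 + r • ((3 : ℤ) • l2) + s • ((3 : ℤ) • l3) := by
  simp only [L1, Submodule.mem_span_insert, Submodule.mem_span_singleton]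
  constructor
  · rintro ⟨p, _, ⟨q, _, ⟨r, _, ⟨s, rfl⟩, rfl⟩, rfl⟩, rfl⟩
    exact ⟨p, q, r, s, by abel⟩
  · rintro ⟨p, q, r, s, rfl⟩
    exact ⟨p, _, ⟨q, _, ⟨r, _, ⟨s, rfl⟩, rfl⟩, rfl⟩, by abel⟩

lemma exists_sub_cosetRep_mem_M {x : Fin 4 → ℤ} (hx : x ∈ L1) : ∃ o, x - cosetRep o ∈ M := by
  have divMod (n : ℤ) : ∃ (k : ℤ) (e : Fin 3), n = 3 * k + (e : ℕ) :=
    ⟨n / 3, ⟨(n % 3).toNat, by omega⟩, by simp only; omega⟩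
  obtain ⟨p, q, r, s, rfl⟩ := (mem_L1_iff x).1 hx
  obtain ⟨k, e, rfl⟩ := divMod p
  obtain ⟨n, f, rfl⟩ := divMod q
  obtain ⟨o, ho⟩ := exists_cosetRep_of_fin_three e f
  refine ⟨o, ?_⟩
  have h : k • ((3 : ℤ) • l0) + n • ((3 : ℤ) • l1) + r • ((3 : ℤ) • l2) +
      s • ((3 : ℤ) • l3) ∈ M := by
    refine add_mem (add_mem (add_mem ?_ ?_) ?_) ?_ <;>
      exact Submodule.smul_mem _ _ ((mem_M_iff _).2 (by decide))
  convert add_mem h ho using 1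
  change _ = _ + (_ • l0 + _ • l1 - _)
  module

lemma M_le_L1 : M ≤ L1 := by
  rw [M, Submodule.span_le]
  rintro x (rfl | rfl | rfl | rfl) <;> rw [SetLike.mem_coe, mem_L1_iff]
  exacts [⟨3, 0, 1, -1, by decide⟩, ⟨3, 3, 1, -2, by decide⟩, ⟨3, 3, 0, -1, by decide⟩,
    ⟨6, 3, 1, -3, by decide⟩]

lemma v_mem_L1 (i : Fin 4) : v i ∈ L1 := by
  rw [mem_L1_iff]
  fin_cases i
  exacts [⟨1, 0, 0, 0, by decide⟩, ⟨0, 1, 0, 0, by decide⟩, ⟨2, 2, 0, -1, by decide⟩,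
    ⟨-4, -2, -1, 2, by decide⟩]

lemma cosetRep_mem_L1 : ∀ o, cosetRep o ∈ L1
  | none => zero_mem _
  | some (_, i) => Submodule.smul_mem _ _ (v_mem_L1 i)

/-- The decomposition of `L₁` into the nine cosets of `M`. -/
noncomputable def cosetEquiv : Option (ℤˣ × Fin 4) × M ≃ L1 :=
  Equiv.ofBijective
    (fun p ↦ ⟨p.2 + cosetRep p.1, add_mem (M_le_L1 p.2.2) (cosetRep_mem_L1 p.1)⟩) <| by
    constructor
    · rintro ⟨o, m⟩ ⟨o', m'⟩ h
      have h : (m : Fin 4 → ℤ) + cosetRep o = m' + cosetRep o' := congrArg Subtype.val h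
      obtain rfl : o = o' := cosetRep_injective_mod_M o o' <| by
        rw [show cosetRep o - cosetRep o' = (m' : Fin 4 → ℤ) - m by
          rw [sub_eq_sub_iff_add_eq_add, add_comm, h]]
        exact sub_mem m'.2 m.2
      rw [Subtype.ext (add_right_cancel h)]
    · rintro ⟨x, hx⟩
      obtain ⟨o, ho⟩ := exists_sub_cosetRep_mem_M hx
      exact ⟨(o, ⟨_, ho⟩), Subtype.ext (sub_add_cancel _ _)⟩

lemma summable_exp_neg_mul_int_sq {s : ℝ} (hs : 0 < s) :
    Summable fun n : ℤ ↦ Real.exp (-s * (n : ℝ) ^ 2) := by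
  have h : Summable fun n : ℕ ↦ Real.exp (-s * (n : ℝ) ^ 2) :=
    Real.summable_exp_nat_mul_of_ge (neg_lt_zero.2 hs) fun n ↦
      mod_cast Nat.le_self_pow two_ne_zero n
  exact .of_nat_of_neg (by simpa using h) (by simpa using h)

lemma Q_nonneg {a b c d : ℝ} (ha : 0 < a) (hb : 0 < b) (hc : 0 < c) (hd : 0 < d)
    (x : Fin 4 → ℤ) : 0 ≤ Q a b c d x := by
  unfold Q; positivity

lemma sq_B_le {a b c d : ℝ} (ha : 0 < a) (hb : 0 < b) (hc : 0 < c) (hd : 0 < d)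
    (x y : Fin 4 → ℤ) : B a b c d x y ^ 2 ≤ Q a b c d x * Q a b c d y := by
  have h : 0 ≤ a * b * ((x 0 : ℝ) * y 1 - x 1 * y 0) ^ 2 +
      a * c * ((x 0 : ℝ) * y 2 - x 2 * y 0) ^ 2 +
      a * d * ((x 0 : ℝ) * y 3 - x 3 * y 0) ^ 2 + b * c * ((x 1 : ℝ) * y 2 - x 2 * y 1) ^ 2 +
      b * d * ((x 1 : ℝ) * y 3 - x 3 * y 1) ^ 2 + c * d * ((x 2 : ℝ) * y 3 - x 3 * y 2) ^ 2 := by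
    positivity
  unfold B Q
  linarith

lemma summable_exp_neg_mul_Q {a b c d : ℝ} (ha : 0 < a) (hb : 0 < b) (hc : 0 < c) (hd : 0 < d)
    {s : ℝ} (hs : 0 < s) :
    Summable fun x : Fin 4 → ℤ ↦ Real.exp (-s * Q a b c d x) := by
  have key {t : ℝ} (ht : 0 < t) := summable_exp_neg_mul_int_sq (mul_pos hs ht)
  have h := ((key ha).mul_of_nonneg (key hb) (fun _ ↦ by positivity)
    fun _ ↦ by positivity).mul_of_nonneg
    ((key hc).mul_of_nonneg (key hd) (fun _ ↦ by positivity) fun _ ↦ by positivity)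
    (fun _ ↦ by positivity) fun _ ↦ by positivity
  have inj : Function.Injective fun x : Fin 4 → ℤ ↦ ((x 0, x 1), (x 2, x 3)) := by
    intro x y hxy
    simp only [Prod.mk.injEq] at hxy
    ext j
    fin_cases j <;> simp [hxy]
  refine (h.comp_injective inj).congr fun x ↦ ?_
  simp only [Function.comp_apply, ← Real.exp_add, Q]
  ring_nf

lemma summable_Q_mul_exp_neg_mul_Q {a b c d : ℝ} (ha : 0 < a) (hb : 0 < b) (hc : 0 < c) (hd : 0 < d)
    {t : ℝ} (ht : 0 < t) :
    Summable fun x : Fin 4 → ℤ ↦ Q a b c d x * Real.exp (-t * Q a b c d x) := by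
  refine ((summable_exp_neg_mul_Q ha hb hc hd (half_pos ht)).mul_left (2 / t)).of_nonneg_of_le
    (fun x ↦ mul_nonneg (Q_nonneg ha hb hc hd x) (Real.exp_nonneg _)) fun x ↦ ?_
  have h : Q a b c d x ≤ 2 / t * Real.exp (t / 2 * Q a b c d x) := by
    have := Real.add_one_le_exp (t / 2 * Q a b c d x)
    calc Q a b c d x = 2 / t * (t / 2 * Q a b c d x) := by field_simp
      _ ≤ _ := by gcongr; linarith
  calc _ ≤ 2 / t * Real.exp (t / 2 * Q a b c d x) * Real.exp (-t * Q a b c d x) := by gcongr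
    _ = _ := by rw [mul_assoc, ← Real.exp_add]; ring_nf

lemma norm_deltaTerm_le {a b c d : ℝ} (ha : 0 < a) (hb : 0 < b) (hc : 0 < c) (hd : 0 < d)
    (τ : ℂ) (x y : Fin 4 → ℤ) :
    ‖deltaTerm a b c d τ x y‖ ≤
      (Q a b c d x * Real.exp (-(2 * Real.pi * τ.im) * Q a b c d x)) *
        (Q a b c d y * Real.exp (-(2 * Real.pi * τ.im) * Q a b c d y)) := by
  have h₁ := sq_B_le ha hb hc hd x y
  have h₂ := sq_B_le ha hb hc hd (Psi x) (Psi y)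
  rw [Q_Psi, Q_Psi] at h₂
  have hB : |B a b c d x y ^ 2 - B a b c d (Psi x) (Psi y) ^ 2| ≤ Q a b c d x * Q a b c d y :=
    abs_sub_le_of_nonneg_of_le (sq_nonneg _) h₁ (sq_nonneg _) h₂
  have hq : ‖qpow τ (Q a b c d x + Q a b c d y)‖ =
      Real.exp (-(2 * Real.pi * τ.im) * Q a b c d x) *
        Real.exp (-(2 * Real.pi * τ.im) * Q a b c d y) := by
    rw [qpow, Complex.norm_exp, ← Real.exp_add]
    congr 1
    simp
    ring
  rw [deltaTerm, norm_mul, Complex.norm_real, Real.norm_eq_abs, hq, mul_mul_mul_comm]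
  gcongr

lemma summable_deltaTerm {a b c d : ℝ} (ha : 0 < a) (hb : 0 < b) (hc : 0 < c) (hd : 0 < d)
    {τ : ℂ} (hτ : 0 < τ.im) :
    Summable fun p : (Fin 4 → ℤ) × (Fin 4 → ℤ) ↦ deltaTerm a b c d τ p.1 p.2 := by
  have h := summable_Q_mul_exp_neg_mul_Q ha hb hc hd (t := 2 * Real.pi * τ.im) (by positivity)
  have nonneg (x : Fin 4 → ℤ) := mul_nonneg (Q_nonneg ha hb hc hd x)
    (Real.exp_nonneg (-(2 * Real.pi * τ.im) * Q a b c d x))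
  exact .of_norm_bounded (h.mul_of_nonneg h nonneg nonneg)
    fun p ↦ norm_deltaTerm_le ha hb hc hd τ p.1 p.2

lemma tsum_L1_eq_sum_deltaCoset {a b c d : ℝ} (ha : 0 < a) (hb : 0 < b) (hc : 0 < c) (hd : 0 < d)
    {τ : ℂ} (hτ : 0 < τ.im) :
    ∑' p : L1 × L1, deltaTerm a b c d τ p.1 p.2 =
      ∑ o, ∑ o', deltaCoset a b c d τ (cosetRep o) (cosetRep o') := by
  have hs : Summable fun p : L1 × L1 ↦ deltaTerm a b c d τ p.1 p.2 :=
    (summable_deltaTerm ha hb hc hd hτ).comp_injective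
      (i := Prod.map ((↑) : L1 → Fin 4 → ℤ) ((↑) : L1 → Fin 4 → ℤ))
      (Subtype.val_injective.prodMap Subtype.val_injective)
  let E := (Equiv.prodProdProdComm (Option (ℤˣ × Fin 4)) (Option (ℤˣ × Fin 4)) M M).trans
    (cosetEquiv.prodCongr cosetEquiv)
  refine (E.tsum_eq _).symm.trans ((E.summable_iff.2 hs).tsum_prod.trans ?_)
  rw [tsum_fintype, Fintype.sum_prod_type]
  rfl

/-- `δ(τ) = Σ_{0 ≤ i < j ≤ 3} δ_{[vᵢ],[vⱼ]}(τ)` : the full difference series over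
`L₁ × L₁` equals `8` times the sum over the classes `[vᵢ] × [vⱼ]` with `i < j`. -/
theorem delta_as_sum_over_pairs (a b c d : ℝ)
    (ha : 0 < a) (hab : a < b) (hbc : b < c) (hcd : c < d)
    (τ : ℂ) (hτ : 0 < τ.im) :
    ∑' p : L1 × L1,
        (((B a b c d (p.1 : Fin 4 → ℤ) (p.2 : Fin 4 → ℤ)) ^ 2 -
            (B a b c d (Psi (p.1 : Fin 4 → ℤ)) (Psi (p.2 : Fin 4 → ℤ))) ^ 2 : ℝ) : ℂ) *
          qpow τ (Q a b c d (p.1 : Fin 4 → ℤ) + Q a b c d (p.2 : Fin 4 → ℤ)) =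
    8 * ∑ ij ∈ Finset.univ.filter (fun ij : Fin 4 × Fin 4 => ij.1 < ij.2),
      ∑' p : M × M,
        (((B a b c d ((p.1 : Fin 4 → ℤ) + v ij.1) ((p.2 : Fin 4 → ℤ) + v ij.2)) ^ 2 -
            (B a b c d (Psi ((p.1 : Fin 4 → ℤ) + v ij.1))
              (Psi ((p.2 : Fin 4 → ℤ) + v ij.2))) ^ 2 : ℝ) : ℂ) *
          qpow τ (Q a b c d ((p.1 : Fin 4 → ℤ) + v ij.1) +
            Q a b c d ((p.2 : Fin 4 → ℤ) + v ij.2)) := by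
  have hb := ha.trans hab
  have hc := hb.trans hbc
  refine (tsum_L1_eq_sum_deltaCoset ha hb hc (hc.trans hcd) hτ).trans ?_
  change _ = 8 * ∑ ij ∈ Finset.univ.filter (fun ij : Fin 4 × Fin 4 => ij.1 < ij.2),
    deltaCoset a b c d τ (v ij.1) (v ij.2)
  simp only [Fintype.sum_option, Fintype.sum_prod_type, cosetRep, deltaCoset_zero_zero,
    deltaCoset_units_smul_left, deltaCoset_units_smul_right, deltaCoset_zero_v,
    deltaCoset_v_zero, Finset.sum_filter, Finset.sum_const, Finset.card_univ, Fin.sum_univ_four,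
    deltaCoset_v_self, Fintype.card_units_int]
  rw [deltaCoset_comm a b c d τ (v 1) (v 0), deltaCoset_comm a b c d τ (v 2) (v 0),
    deltaCoset_comm a b c d τ (v 3) (v 0), deltaCoset_comm a b c d τ (v 2) (v 1),
    deltaCoset_comm a b c d τ (v 3) (v 1), deltaCoset_comm a b c d τ (v 3) (v 2)]
  simp
  ring
end

section
/- An element w of the coset v₂ + M is minimal with respect to ≺ (i.e., there is no w' ∈ v₂ + M with w' ≺ w) if and only if w = v₂ = (3,1,−1,−1). -/
/-- The partial preorder `≼` on `ℕ⁴`: `n ≼ n'` iff `Σ_{i ≥ i₀} nᵢ ≤ Σ_{i ≥ i₀} n'ᵢ`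
for every `i₀`. -/
def preceq (n n' : Fin 4 → ℕ) : Prop :=
  ∀ i0 : Fin 4, ∑ i ∈ Finset.univ.filter (fun i => i0 ≤ i), n i ≤
    ∑ i ∈ Finset.univ.filter (fun i => i0 ≤ i), n' i

/-- The strict relation `≺`: `n ≺ n'` iff `n ≼ n'` but not `n' ≼ n`. -/
def precl (n n' : Fin 4 → ℕ) : Prop := preceq n n' ∧ ¬ preceq n' n

/-- `φ : ℤ⁴ → ℕ⁴`, `φ(x) = (x₀², x₁², x₂², x₃²)`. -/
def phi (x : Fin 4 → ℤ) : Fin 4 → ℕ := fun i => (x i).natAbs ^ 2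

theorem exists_coeff_of_mem_M {x : Fin 4 → ℤ} (hx : x ∈ M) :
    ∃ a b c d : ℤ, x 0 = 3 * (a + b + c + d) - 6 * a ∧ x 1 = 3 * (a + b + c + d) - 6 * b ∧
      x 2 = 3 * (a + b + c + d) - 6 * c ∧ x 3 = 3 * (a + b + c + d) - 6 * d := by
  simp only [M, Submodule.mem_span_insert, Submodule.mem_span_singleton] at hx
  obtain ⟨a, _, ⟨b, _, ⟨c, _, ⟨d, rfl⟩, rfl⟩, rfl⟩, rfl⟩ := hx
  refine ⟨a, b, c, d, ?_, ?_, ?_, ?_⟩ <;> simp <;> ring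

theorem preceq_phi_iff (x y : Fin 4 → ℤ) :
    preceq (phi x) (phi y) ↔
      x 0 ^ 2 + x 1 ^ 2 + x 2 ^ 2 + x 3 ^ 2 ≤ y 0 ^ 2 + y 1 ^ 2 + y 2 ^ 2 + y 3 ^ 2 ∧
      x 1 ^ 2 + x 2 ^ 2 + x 3 ^ 2 ≤ y 1 ^ 2 + y 2 ^ 2 + y 3 ^ 2 ∧
      x 2 ^ 2 + x 3 ^ 2 ≤ y 2 ^ 2 + y 3 ^ 2 ∧ x 3 ^ 2 ≤ y 3 ^ 2 := by
  simp only [preceq, phi, Finset.sum_filter, Fin.sum_univ_four, Fin.forall_fin_succ,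
    ← Int.ofNat_le]
  simp [Fin.le_def, add_assoc]

theorem preceq_phi_v_two {w : Fin 4 → ℤ} (hw : w - v 2 ∈ M) : preceq (phi (v 2)) (phi w) := by
  obtain ⟨a, b, c, d, h0, h1, h2, h3⟩ := exists_coeff_of_mem_M hw
  simp [v] at h0 h1 h2 h3
  have sq_ge {k z : ℤ} (hk : 0 ≤ k) (hz : z ≤ -k ∨ k ≤ z) : k ^ 2 ≤ z ^ 2 := by
    rcases hz with hz | hz <;> nlinarith
  rw [preceq_phi_iff]
  simp only [v, Matrix.cons_val]
  rcases Int.even_or_odd' (a + b + c + d) with ⟨s, hs | hs⟩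
  · have e0 : (3 : ℤ) ^ 2 ≤ w 0 ^ 2 := sq_ge (by norm_num) (by omega)
    have e1 : (1 : ℤ) ^ 2 ≤ w 1 ^ 2 := sq_ge (by norm_num) (by omega)
    have e2 : (1 : ℤ) ^ 2 ≤ w 2 ^ 2 := sq_ge (by norm_num) (by omega)
    have e3 : (1 : ℤ) ^ 2 ≤ w 3 ^ 2 := sq_ge (by norm_num) (by omega)
    refine ⟨?_, ?_, ?_, ?_⟩ <;> linarith
  · have e0 := sq_nonneg (w 0)
    have e1 : (2 : ℤ) ^ 2 ≤ w 1 ^ 2 := sq_ge (by norm_num) (by omega)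
    have e2 : (2 : ℤ) ^ 2 ≤ w 2 ^ 2 := sq_ge (by norm_num) (by omega)
    have e3 : (2 : ℤ) ^ 2 ≤ w 3 ^ 2 := sq_ge (by norm_num) (by omega)
    refine ⟨?_, ?_, ?_, ?_⟩ <;> linarith

theorem eq_v_two_of_preceq {w : Fin 4 → ℤ} (hw : w - v 2 ∈ M)
    (h : preceq (phi w) (phi (v 2))) : w = v 2 := by
  have h' := preceq_phi_v_two hw
  obtain ⟨a, b, c, d, h0, h1, h2, h3⟩ := exists_coeff_of_mem_M hw
  rw [preceq_phi_iff] at h h'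
  simp only [v, Matrix.cons_val] at h h'
  simp [v] at h0 h1 h2 h3
  have e0 : w 0 = 3 ∨ w 0 = -3 := sq_eq_sq_iff_eq_or_eq_neg.mp (by linarith)
  have e1 : w 1 = 1 ∨ w 1 = -1 := sq_eq_sq_iff_eq_or_eq_neg.mp (by linarith)
  have e2 : w 2 = 1 ∨ w 2 = -1 := sq_eq_sq_iff_eq_or_eq_neg.mp (by linarith)
  have e3 : w 3 = 1 ∨ w 3 = -1 := sq_eq_sq_iff_eq_or_eq_neg.mp (by linarith)
  ext i
  fin_cases i <;> simp [v] <;> omega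

/-- The unique minimal vector of the coset `v₂ + M` with respect to `≺` is
`v₂ = (3,1,−1,−1)`. -/
theorem minimal_vectors_class_v2 (w : Fin 4 → ℤ) (hw : w - v 2 ∈ M) :
    (¬ ∃ w' : Fin 4 → ℤ, w' - v 2 ∈ M ∧ precl (phi w') (phi w)) ↔ w = v 2 := by
  constructor
  · intro hmin
    by_contra hne
    exact hmin ⟨v 2, by simp, preceq_phi_v_two hw, fun h => hne (eq_v_two_of_preceq hw h)⟩
  · rintro rfl ⟨w', hw', -, hlt⟩
    exact hlt (preceq_phi_v_two hw')
end
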